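/- Let α = (φ,σ) be a minimal action of ℤ⋊ℤ₂ on a Cantor set X such that the ℤ-action induced by φ is minimal and α is free. Then H_0(ℤ⋊ℤ₂, C(X,ℤ)) ≅ ℤ/2ℤ ⊕ (1+σ_*)H_0(ℤ, C(X,ℤ)), and H_n(ℤ⋊ℤ₂, C(X,ℤ)) = 0 for every n ≥ 1. -/

import Mathlib

section GroupHomologyDef

variable (G M : Type*) [Group G] [AddCommGroup M] [DistribMulAction G M]

/-- The differential on inhomogeneous chains computing the homology of the group `G` with
coefficients in the `G`-module `M` (for the left action of `G` on `M`; a right module is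
regarded as a left module by acting by inverses, which does not change homology). -/
noncomputable def inhomogeneousChainsD (n : ℕ) :
    ((Fin (n + 1) → G) →₀ M) →+ ((Fin n → G) →₀ M) :=
  Finsupp.liftAddHom fun g =>
    { toFun := fun m =>
        Finsupp.single (fun i => g i.succ) ((g 0)⁻¹ • m) +
          ∑ j : Fin (n + 1),
            (-1 : ℤ) ^ ((j : ℕ) + 1) • Finsupp.single (Fin.contractNth j (· * ·) g) m
      map_zero' := by simp
      map_add' := fun a b => by
        simp only [smul_add, Finsupp.single_add, Finset.sum_add_distrib]
        abel }

/-- The subgroup of `n`-cycles of the complex of inhomogeneous chains. -/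
noncomputable def homologyCycles : ∀ n : ℕ, AddSubgroup ((Fin n → G) →₀ M)
  | 0 => ⊤
  | (m + 1) => (inhomogeneousChainsD G M m).ker

/-- The `n`-th homology group `Hₙ(G, M)` of the group `G` with coefficients in the
`G`-module `M`: the quotient of the `n`-cycles by the `n`-boundaries of the complex of
inhomogeneous chains. -/
noncomputable def GroupHomology (n : ℕ) : Type _ :=
  homologyCycles G M n ⧸
    ((inhomogeneousChainsD G M n).range.addSubgroupOf (homologyCycles G M n))

noncomputable instance (n : ℕ) : AddCommGroup (GroupHomology G M n) :=
  QuotientAddGroup.Quotient.addCommGroup _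

end GroupHomologyDef

variable {X : Type*} [TopologicalSpace X]

/-- The subgroup `B = {h - h ∘ ψ : h ∈ C(Z, ℤ)}` of `C(Z, ℤ)`. -/
def coboundariesSubgroup {Z : Type*} [TopologicalSpace Z] (ψ : C(Z, Z)) :
    AddSubgroup C(Z, ℤ) :=
  (AddMonoidHom.mk' (fun h : C(Z, ℤ) => h - h.comp ψ)
    (fun f g => by ext x; simp; ring)).range

/-- The subgroup `(1 + σ_*) H₀(ℤ, C(X, ℤ)) = {[f + f ∘ σ] : f ∈ C(X, ℤ)}` of the
coinvariants `H₀(ℤ, C(X, ℤ)) = C(X, ℤ) ⧸ {h - h ∘ φ}`. -/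
def onePlusSigmaStar (φ σ : X ≃ₜ X) :
    AddSubgroup (C(X, ℤ) ⧸ coboundariesSubgroup (φ : C(X, X))) :=
  AddSubgroup.map (QuotientAddGroup.mk' (coboundariesSubgroup (φ : C(X, X))))
    (AddMonoidHom.mk' (fun f : C(X, ℤ) => f + f.comp (σ : C(X, X)))
      (fun f g => by ext x; simp; ring)).range

section GroupHomologyVanishing

variable {G : Type*} [Group G]

theorem inhomogeneousChainsD_single {M : Type*} [AddCommGroup M] [DistribMulAction G M]
    (n : ℕ) (g : Fin (n + 1) → G) (m : M) :
    inhomogeneousChainsD G M n (Finsupp.single g m) =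
      Finsupp.single (fun i => g i.succ) ((g 0)⁻¹ • m) +
        ∑ j : Fin (n + 1),
          (-1 : ℤ) ^ ((j : ℕ) + 1) • Finsupp.single (Fin.contractNth j (· * ·) g) m := by
  simp [inhomogeneousChainsD]

/-- The homology of `G` with coefficients in `M` vanishes in degree `n + 1`. -/
def VanishesInDegreeSucc (G M : Type*) [Group G] [AddCommGroup M] [DistribMulAction G M]
    (n : ℕ) : Prop :=
  ∀ c, inhomogeneousChainsD G M n c = 0 → ∃ w, inhomogeneousChainsD G M (n + 1) w = c

theorem GroupHomology.eq_zero_of_vanishesInDegreeSucc {M : Type*} [AddCommGroup M]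
    [DistribMulAction G M] {n : ℕ} (h : VanishesInDegreeSucc G M n)
    (x : GroupHomology G M (n + 1)) : x = 0 := by
  obtain ⟨⟨c, hc⟩, rfl⟩ := QuotientAddGroup.mk_surjective x
  obtain ⟨w, hw⟩ := h c hc
  exact (QuotientAddGroup.eq_zero_iff _).2 ⟨w, hw⟩

theorem inhomogeneousChainsD_mapRange {A B : Type*} [AddCommGroup A] [DistribMulAction G A]
    [AddCommGroup B] [DistribMulAction G B] (f : A →+ B) (hf : ∀ (g : G) a, f (g • a) = g • f a)
    (n : ℕ) (c : (Fin (n + 1) → G) →₀ A) :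
    inhomogeneousChainsD G B n (Finsupp.mapRange.addMonoidHom f c) =
      Finsupp.mapRange.addMonoidHom f (inhomogeneousChainsD G A n c) := by
  induction c using Finsupp.induction_linear with
  | zero => simp
  | add a b ha hb => simp only [map_add, ha, hb]
  | single g a =>
    simp only [Finsupp.mapRange.addMonoidHom_apply, Finsupp.mapRange_single]
    rw [← Finsupp.mapRange.addMonoidHom_apply]
    simp only [inhomogeneousChainsD_single, map_add, map_sum, map_zsmul,
      Finsupp.mapRange.addMonoidHom_apply, Finsupp.mapRange_single, hf]

theorem contractNth_zero_cons (n : ℕ) (a : G) (g : Fin (n + 1) → G) :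
    Fin.contractNth 0 (· * ·) (Fin.cons a g : Fin (n + 2) → G) =
      Fin.cons (a * g 0) (fun i => g i.succ) := by
  funext k
  refine Fin.cases ?_ (fun k => ?_) k <;> simp [Fin.contractNth]

theorem contractNth_succ_cons (n : ℕ) (j : Fin (n + 1)) (a : G) (g : Fin (n + 1) → G) :
    Fin.contractNth j.succ (· * ·) (Fin.cons a g : Fin (n + 2) → G) =
      Fin.cons a (Fin.contractNth j (· * ·) g) := by
  funext k
  refine Fin.cases ?_ (fun k => ?_) k
  · simp [Fin.contractNth]
  · simp [Fin.contractNth]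

theorem inhomogeneousChainsD_one_single {M : Type*} [AddCommGroup M] [DistribMulAction G M]
    (g : Fin 2 → G) (m : M) :
    inhomogeneousChainsD G M 1 (Finsupp.single g m) =
      Finsupp.single (fun _ => g 1) ((g 0)⁻¹ • m) - Finsupp.single (fun _ => g 0 * g 1) m +
        Finsupp.single (fun _ => g 0) m := by
  have h0 : Fin.contractNth 0 (· * ·) g = fun _ => g 0 * g 1 := by
    funext i; fin_cases i; simp [Fin.contractNth]
  have h1 : Fin.contractNth 1 (· * ·) g = fun _ => g 0 := by
    funext i; fin_cases i; simp [Fin.contractNth]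
  have h2 : (fun i : Fin 1 => g i.succ) = fun _ => g 1 := by
    funext i; fin_cases i; rfl
  rw [inhomogeneousChainsD_single, Fin.sum_univ_two, h0, h1, h2]
  simp [sub_eq_add_neg, add_assoc]

theorem inhomogeneousChainsD_zero_single {M : Type*} [AddCommGroup M] [DistribMulAction G M]
    (g : Fin 1 → G) (m : M) :
    inhomogeneousChainsD G M 0 (Finsupp.single g m) =
      Finsupp.single default ((g 0)⁻¹ • m - m) := by
  rw [inhomogeneousChainsD_single]
  simp [sub_eq_add_neg, Subsingleton.elim _ (default : Fin 0 → G)]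

theorem inhomogeneousChainsD_zero_comp_one {M : Type*} [AddCommGroup M] [DistribMulAction G M]
    (c : (Fin 2 → G) →₀ M) :
    inhomogeneousChainsD G M 0 (inhomogeneousChainsD G M 1 c) = 0 := by
  induction c using Finsupp.induction_linear with
  | zero => simp
  | add a b ha hb => simp only [map_add, ha, hb, add_zero]
  | single g a =>
    rw [inhomogeneousChainsD_one_single]
    simp only [map_add, map_sub, inhomogeneousChainsD_zero_single]
    simp only [← Finsupp.single_add, ← Finsupp.single_sub, mul_inv_rev, mul_smul]
    simp

/-- The module `ℤ[G] ⊗ M` with the diagonal action of `G`. -/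
def DiagonalModule (G M : Type*) [AddCommGroup M] : Type _ := G →₀ M

namespace DiagonalModule

section Basic

variable {G M : Type*} [AddCommGroup M]

noncomputable instance : AddCommGroup (DiagonalModule G M) :=
  inferInstanceAs (AddCommGroup (G →₀ M))

noncomputable instance : FunLike (DiagonalModule G M) G M :=
  inferInstanceAs (FunLike (G →₀ M) G M)

/-- The element `x ⊗ m`. -/
noncomputable def tmul (x : G) : M →+ DiagonalModule G M := Finsupp.singleAddHom x

theorem induction_on {p : DiagonalModule G M → Prop} (f : DiagonalModule G M) (h0 : p 0)
    (hadd : ∀ a b, p a → p b → p (a + b)) (ht : ∀ x m, p (tmul x m)) : p f :=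
  Finsupp.induction_linear (motive := p) f h0 hadd ht

/-- The additive map out of `ℤ[G] ⊗ M` with prescribed values on the elements `x ⊗ m`. -/
noncomputable def lift {N : Type*} [AddCommGroup N] (F : G → M →+ N) :
    DiagonalModule G M →+ N :=
  (Finsupp.liftAddHom F : (G →₀ M) →+ N)

theorem lift_tmul {N : Type*} [AddCommGroup N] (F : G → M →+ N) (x : G) (m : M) :
    lift F (tmul x m) = F x m := Finsupp.liftAddHom_apply_single F x m

/-- The augmentation `ℤ[G] ⊗ M → M`. -/
noncomputable def augmentation (G M : Type*) [AddCommGroup M] : DiagonalModule G M →+ M :=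
  lift fun _ => AddMonoidHom.id M

theorem augmentation_tmul (x : G) (m : M) : augmentation G M (tmul x m) = m :=
  lift_tmul _ x m

theorem chain_induction {n : ℕ} {p : ((Fin n → G) →₀ DiagonalModule G M) → Prop}
    (c : (Fin n → G) →₀ DiagonalModule G M) (h0 : p 0)
    (hadd : ∀ a b, p a → p b → p (a + b)) (ht : ∀ g x m, p (Finsupp.single g (tmul x m))) :
    p c := by
  induction c using Finsupp.induction_linear with
  | zero => exact h0
  | add a b ha hb => exact hadd a b ha hb
  | single g f =>
    induction f using induction_on with
    | h0 => simpa using h0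
    | hadd a b ha hb => rw [Finsupp.single_add]; exact hadd _ _ ha hb
    | ht x m => exact ht g x m

end Basic

section RightMul

variable {M : Type*} [AddCommGroup M]

/-- Right translation on `ℤ[G] ⊗ M`. -/
noncomputable def rightMul (y : G) : DiagonalModule G M →+ DiagonalModule G M :=
  lift fun x => tmul (x * y)

theorem rightMul_tmul (x y : G) (m : M) : rightMul y (tmul x m) = tmul (x * y) m :=
  lift_tmul _ x m

end RightMul

variable {M : Type*} [AddCommGroup M] [DistribMulAction G M]

noncomputable instance : DistribMulAction G (DiagonalModule G M) where
  smul g f := (Finsupp.mapRange (g • ·) (smul_zero g)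
    (Finsupp.equivMapDomain (Equiv.mulLeft g) f) : G →₀ M)
  one_smul f := Finsupp.ext fun x => show (1 : G) • f ((1 : G)⁻¹ * x) = f x by simp
  mul_smul g h f := Finsupp.ext fun x =>
    show (g * h) • f ((g * h)⁻¹ * x) = g • h • f (h⁻¹ * (g⁻¹ * x)) by
      simp [mul_smul, mul_assoc]
  smul_zero g := Finsupp.ext fun x => show g • (0 : M) = 0 by simp
  smul_add g f f' := Finsupp.ext fun x => smul_add g (f (g⁻¹ * x)) (f' (g⁻¹ * x))

theorem smul_apply (g : G) (f : DiagonalModule G M) (x : G) :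
    (g • f) x = g • f (g⁻¹ * x) := rfl

theorem smul_tmul (g x : G) (m : M) : g • tmul x m = tmul (g * x) (g • m) := by
  show Finsupp.mapRange _ _ (Finsupp.equivMapDomain _ (Finsupp.single x m)) = _
  rw [Finsupp.equivMapDomain_single, Finsupp.mapRange_single]
  rfl

theorem augmentation_smul (g : G) (f : DiagonalModule G M) :
    augmentation G M (g • f) = g • augmentation G M f := by
  induction f using induction_on with
  | h0 => simp
  | hadd a b ha hb => simp only [smul_add, map_add, ha, hb]
  | ht x m => simp only [smul_tmul, augmentation_tmul]

theorem rightMul_smul (y g : G) (f : DiagonalModule G M) :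
    rightMul y (g • f) = g • rightMul y f := by
  induction f using induction_on with
  | h0 => simp
  | hadd a b ha hb => simp only [smul_add, map_add, ha, hb]
  | ht x m => simp only [smul_tmul, rightMul_tmul, mul_assoc]

/-- A contracting homotopy of the complex of inhomogeneous chains of `ℤ[G] ⊗ M`. -/
noncomputable def homotopy (n : ℕ) :
    ((Fin n → G) →₀ DiagonalModule G M) →+ ((Fin (n + 1) → G) →₀ DiagonalModule G M) :=
  Finsupp.liftAddHom fun g => lift fun x =>
    (Finsupp.singleAddHom (Fin.cons x⁻¹ g)).comp
      ((tmul 1).comp (DistribSMul.toAddMonoidHom M x⁻¹))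

theorem homotopy_single (n : ℕ) (g : Fin n → G) (x : G) (m : M) :
    homotopy n (Finsupp.single g (tmul x m)) =
      Finsupp.single (Fin.cons x⁻¹ g : Fin (n + 1) → G) (tmul 1 (x⁻¹ • m)) := by
  rw [homotopy, Finsupp.liftAddHom_apply_single, lift_tmul]
  rfl

theorem inhomogeneousChainsD_homotopy (n : ℕ) (c : (Fin (n + 1) → G) →₀ DiagonalModule G M) :
    inhomogeneousChainsD G _ (n + 1) (homotopy (n + 1) c) =
      c - homotopy n (inhomogeneousChainsD G _ n c) := by
  induction c using chain_induction with
  | h0 => simp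
  | hadd a b ha hb => simp only [map_add, ha, hb]; abel
  | ht g x m =>
    rw [homotopy_single, inhomogeneousChainsD_single, inhomogeneousChainsD_single,
      Fin.sum_univ_succ, contractNth_zero_cons]
    simp only [contractNth_succ_cons, Fin.cons_succ, Fin.cons_zero, smul_tmul, map_add, map_sum,
      map_zsmul, homotopy_single, inv_inv, mul_one, smul_inv_smul, mul_inv_rev]
    simp [pow_succ, mul_smul, sub_eq_add_neg]
    abel

theorem inhomogeneousChainsD_comp (n : ℕ) (c : (Fin (n + 2) → G) →₀ DiagonalModule G M) :
    inhomogeneousChainsD G _ n (inhomogeneousChainsD G _ (n + 1) c) = 0 := by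
  induction n with
  | zero => exact inhomogeneousChainsD_zero_comp_one c
  | succ n ih =>
    have key : ∀ c : (Fin (n + 2) → G) →₀ DiagonalModule G M,
        inhomogeneousChainsD G _ (n + 1)
          (inhomogeneousChainsD G _ (n + 2) (homotopy (n + 2) c)) = 0 := fun c => by
      rw [inhomogeneousChainsD_homotopy, map_sub, inhomogeneousChainsD_homotopy, ih]
      simp
    induction c using chain_induction with
    | h0 => simp
    | hadd a b ha hb => simp only [map_add, ha, hb, add_zero]
    | ht g x m =>
      have h1 : Finsupp.single g (tmul x m) =
          Finsupp.mapRange.addMonoidHom (rightMul x)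
            (homotopy (n + 2) (Finsupp.single (Fin.tail g) (tmul (g 0)⁻¹ ((g 0)⁻¹ • m)))) := by
        rw [homotopy_single, Finsupp.mapRange.addMonoidHom_apply, Finsupp.mapRange_single,
          rightMul_tmul]
        simp
      rw [h1, inhomogeneousChainsD_mapRange _ (rightMul_smul x),
        inhomogeneousChainsD_mapRange _ (rightMul_smul x), key, map_zero]

/-- The kernel of the augmentation. -/
abbrev AugmentationKernel (G M : Type*) [AddCommGroup M] : Type _ :=
  (augmentation G M).ker

noncomputable instance : DistribMulAction G (AugmentationKernel G M) where
  smul g f := ⟨g • f.1, by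
    rw [AddMonoidHom.mem_ker, augmentation_smul, AddMonoidHom.mem_ker.1 f.2, smul_zero]⟩
  one_smul f := Subtype.ext (one_smul G f.1)
  mul_smul g h f := Subtype.ext (mul_smul g h f.1)
  smul_zero g := Subtype.ext (smul_zero g)
  smul_add g a b := Subtype.ext (smul_add g a.1 b.1)

theorem coe_smul (g : G) (f : AugmentationKernel G M) :
    ((g • f : AugmentationKernel G M) : DiagonalModule G M) = g • (f : DiagonalModule G M) := rfl

theorem vanishesInDegreeSucc_succ {n : ℕ}
    (h : VanishesInDegreeSucc G (AugmentationKernel G M) n) :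
    VanishesInDegreeSucc G M (n + 1) := by
  intro c hc
  set π := augmentation G M
  have hπ := augmentation_smul (G := G) (M := M)
  have hι : ∀ (g : G) (a : AugmentationKernel G M), π.ker.subtype (g • a) = g • π.ker.subtype a :=
    fun _ _ => rfl
  have hsec : ∀ {k : ℕ} (c : (Fin k → G) →₀ M), Finsupp.mapRange.addMonoidHom π
      (Finsupp.mapRange.addMonoidHom (tmul (1 : G)) c) = c := fun c => by
    ext g
    simp [π, augmentation_tmul]
  have hker : ∀ {k : ℕ} (c : (Fin k → G) →₀ DiagonalModule G M),
      Finsupp.mapRange.addMonoidHom π c = 0 →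
      ∃ c', Finsupp.mapRange.addMonoidHom π.ker.subtype c' = c := fun c hc => by
    have hm : ∀ x, c x ∈ π.ker := fun x => by
      simpa using DFunLike.congr_fun hc x
    refine ⟨Finsupp.onFinset c.support (fun x => ⟨c x, hm x⟩) fun x hx => ?_, ?_⟩
    · rw [Finsupp.mem_support_iff]
      exact fun h0 => hx (Subtype.ext h0)
    · ext x
      simp
  set y := Finsupp.mapRange.addMonoidHom (tmul (1 : G)) c
  obtain ⟨z', hz'⟩ := hker (inhomogeneousChainsD G _ (n + 1) y) (by
    rw [← inhomogeneousChainsD_mapRange π hπ, hsec, hc])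
  have hinj : Function.Injective (Finsupp.mapRange.addMonoidHom (ι := Fin n → G)
      π.ker.subtype) := fun a b hab => by
    ext x
    simpa using DFunLike.congr_fun hab x
  obtain ⟨z, hz⟩ := h z' (hinj (by
    rw [← inhomogeneousChainsD_mapRange _ hι, hz', inhomogeneousChainsD_comp, map_zero]))
  set u := y - Finsupp.mapRange.addMonoidHom π.ker.subtype z
  have hu : inhomogeneousChainsD G _ (n + 1) u = 0 := by
    rw [map_sub, inhomogeneousChainsD_mapRange _ hι, hz, hz', sub_self]
  refine ⟨Finsupp.mapRange.addMonoidHom π (homotopy (n + 2) u), ?_⟩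
  rw [inhomogeneousChainsD_mapRange π hπ, inhomogeneousChainsD_homotopy, hu, map_zero, sub_zero,
    map_sub, hsec, sub_eq_self]
  ext x
  simp only [Finsupp.mapRange.addMonoidHom_apply, Finsupp.mapRange_apply, Finsupp.coe_zero,
    Pi.zero_apply]
  exact (z x).2

theorem eq_zero_of_smul_eq_self {r : G} (hr : Function.Injective fun k : ℕ => r ^ k)
    {f : DiagonalModule G M} (hf : r • f = f) : f = 0 := by
  by_contra hne
  obtain ⟨x, hx⟩ : ∃ x, f x ≠ 0 := by
    by_contra! h
    exact hne (Finsupp.ext h)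
  have hpow : ∀ k : ℕ, r ^ k • f = f := fun k => by
    induction k with
    | zero => simp
    | succ k ih => rw [pow_succ, mul_smul, hf, ih]
  have hmem : ∀ k : ℕ, (r ^ k)⁻¹ * x ∈ (show G →₀ M from f).support := fun k => by
    rw [Finsupp.mem_support_iff]
    intro h0
    apply hx
    rw [← hpow k, smul_apply]
    exact (congrArg (r ^ k • ·) h0).trans (smul_zero _)
  exact Set.infinite_of_injective_forall_mem (f := fun k : ℕ => (r ^ k)⁻¹ * x)
    (fun a b hab => hr (by simpa using hab)) hmem (Finset.finite_toSet _)

end DiagonalModule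

/-- Conditions on a module over a group generated by two involutions `s` and `t` which force
its homology to vanish in positive degrees: the restrictions to the subgroups generated by
`s` and by `t` are induced, and there is no nonzero vector negated by both. -/
structure AcyclicPair (M : Type*) [AddCommGroup M] [DistribMulAction G M] (s t : G) : Prop where
  left : ∃ p : M →+ M, ∀ m, s • p m + p (s • m) = s • m
  right : ∃ p : M →+ M, ∀ m, t • p m + p (t • m) = t • m
  eq_zero : ∀ m : M, s • m = -m → t • m = -m → m = 0

namespace AcyclicPair

variable {M : Type*} [AddCommGroup M] [DistribMulAction G M] {s t : G}

theorem exists_projection_augmentationKernel {g : G}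
    (h : ∃ p : M →+ M, ∀ m, g • p m + p (g • m) = g • m) :
    ∃ p : DiagonalModule.AugmentationKernel G M →+ DiagonalModule.AugmentationKernel G M,
      ∀ m, g • p m + p (g • m) = g • m := by
  obtain ⟨p, hp⟩ := h
  set P : DiagonalModule G M →+ DiagonalModule G M :=
    DiagonalModule.lift fun x => (DiagonalModule.tmul x).comp p
  have hP : ∀ x m, P (DiagonalModule.tmul x m) = DiagonalModule.tmul x (p m) := fun x m =>
    DiagonalModule.lift_tmul _ x m
  have hPg : ∀ f, g • P f + P (g • f) = g • f := fun f => by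
    induction f using DiagonalModule.induction_on with
    | h0 => simp
    | hadd a b ha hb =>
      simp only [map_add, smul_add]
      rw [add_add_add_comm, ha, hb]
    | ht x m => simp only [DiagonalModule.smul_tmul, hP, ← map_add, hp]
  have haug : ∀ f, DiagonalModule.augmentation G M (P f) = p (DiagonalModule.augmentation G M f) :=
    fun f => by
      induction f using DiagonalModule.induction_on with
      | h0 => simp
      | hadd a b ha hb => simp only [map_add, ha, hb]
      | ht x m => simp only [DiagonalModule.augmentation_tmul, hP]
  refine ⟨(P.comp (AddSubgroup.subtype _)).codRestrict _ fun f => ?_, fun f => ?_⟩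
  · rw [AddMonoidHom.mem_ker]
    exact (haug f).trans (by rw [AddMonoidHom.mem_ker.1 f.2, map_zero])
  · exact Subtype.ext (hPg f)

theorem augmentationKernel (h : AcyclicPair M s t)
    (hst : Function.Injective fun k : ℕ => (s * t) ^ k) :
    AcyclicPair (DiagonalModule.AugmentationKernel G M) s t where
  left := exists_projection_augmentationKernel h.left
  right := exists_projection_augmentationKernel h.right
  eq_zero m hs ht := Subtype.ext <| DiagonalModule.eq_zero_of_smul_eq_self hst <| by
    rw [← DiagonalModule.coe_smul, mul_smul, ht, smul_neg, hs, neg_neg]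

theorem vanishesInDegreeSucc_zero (h : AcyclicPair M s t) (hs : s * s = 1) (ht : t * t = 1)
    (hgen : Subgroup.closure {s, t} = ⊤) : VanishesInDegreeSucc G M 0 := by
  set q := QuotientAddGroup.mk' (inhomogeneousChainsD G M 1).range
  set cls : G → M →+ _ := fun x => q.comp (Finsupp.singleAddHom fun _ => x) with hcls
  have hmul : ∀ x y m, cls (x * y) m = cls y (x⁻¹ • m) + cls x m := fun x y m => by
    have h0 : q (inhomogeneousChainsD G M 1 (Finsupp.single ![x, y] m)) = 0 :=
      (QuotientAddGroup.eq_zero_iff _).2 ⟨_, rfl⟩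
    rw [inhomogeneousChainsD_one_single, map_add, map_sub] at h0
    rw [← sub_eq_zero, ← neg_eq_zero, ← h0]
    simp only [hcls, AddMonoidHom.comp_apply, Finsupp.singleAddHom_apply, Matrix.cons_val_zero,
      Matrix.cons_val_one]
    abel
  have hone : ∀ m, cls 1 m = 0 := fun m => by simpa using hmul 1 1 m
  have hnorm : ∀ {g : G}, g * g = 1 → (∃ p : M →+ M, ∀ m, g • p m + p (g • m) = g • m) →
      ∀ m, g • m = m → cls g m = 0 := by
    rintro g hg ⟨p, hp⟩ m hm
    have h1 := hmul g g (p m)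
    rw [hg, hone, inv_eq_of_mul_eq_one_left hg, ← map_add] at h1
    have h2 := hp m
    rw [hm] at h2
    rw [h1, h2]
  have hspan : ∀ x m, ∃ a b, cls x m = cls s a + cls t b := fun x => by
    have hx : x ∈ Subgroup.closure {s, t} := hgen ▸ Subgroup.mem_top x
    induction hx using Subgroup.closure_induction with
    | mem x hx =>
      rintro m
      rcases hx with rfl | rfl
      · exact ⟨m, 0, by simp⟩
      · exact ⟨0, m, by simp⟩
    | one => exact fun m => ⟨0, 0, by simp [hone]⟩
    | mul x y _ _ ihx ihy =>
      intro m
      obtain ⟨a, b, hab⟩ := ihx m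
      obtain ⟨a', b', hab'⟩ := ihy (x⁻¹ • m)
      exact ⟨a' + a, b' + b, by rw [hmul, hab, hab', map_add, map_add]; abel⟩
    | inv x _ ih =>
      intro m
      obtain ⟨a, b, hab⟩ := ih (x • m)
      have h1 := hmul x⁻¹ x m
      rw [inv_mul_cancel, hone, inv_inv, hab] at h1
      refine ⟨-a, -b, ?_⟩
      rw [map_neg, map_neg, eq_neg_of_add_eq_zero_right h1.symm]
      abel
  intro c hc
  obtain ⟨a, b, hab⟩ : ∃ a b, q c = cls s a + cls t b := by
    clear hc
    induction c using Finsupp.induction_linear with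
    | zero => exact ⟨0, 0, by simp⟩
    | add c c' ih ih' =>
      obtain ⟨a, b, hab⟩ := ih
      obtain ⟨a', b', hab'⟩ := ih'
      exact ⟨a + a', b + b', by rw [map_add, hab, hab', map_add, map_add]; abel⟩
    | single g m =>
      obtain ⟨a, b, hab⟩ := hspan (g 0) m
      refine ⟨a, b, hab ▸ ?_⟩
      have : g = fun _ => g 0 := funext fun i => congrArg g (Fin.fin_one_eq_zero i)
      conv_lhs => rw [this]
      rfl
  have hD : s • a - a + (t • b - b) = 0 := by
    have h1 : q (c - (Finsupp.single (fun _ => s) a + Finsupp.single (fun _ => t) b)) = 0 := by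
      rw [map_sub, map_add, hab, sub_eq_zero]
      rfl
    obtain ⟨w, hw⟩ := (QuotientAddGroup.eq_zero_iff _).1 h1
    have h2 := congrArg (inhomogeneousChainsD G M 0) hw
    rw [inhomogeneousChainsD_zero_comp_one, map_sub, hc, map_add,
      inhomogeneousChainsD_zero_single, inhomogeneousChainsD_zero_single,
      inv_eq_of_mul_eq_one_left hs, inv_eq_of_mul_eq_one_left ht, ← Finsupp.single_add,
      zero_sub, eq_comm, neg_eq_zero, Finsupp.single_eq_zero] at h2
    exact h2
  have hf : s • a - a = 0 := by
    apply h.eq_zero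
    · rw [smul_sub, ← mul_smul, hs, one_smul, neg_sub]
    · rw [eq_neg_of_add_eq_zero_left hD, neg_sub, smul_sub, ← mul_smul, ht, one_smul, neg_sub]
  rw [hf, zero_add] at hD
  rw [hnorm hs h.left a (sub_eq_zero.1 hf), hnorm ht h.right b (sub_eq_zero.1 hD),
    add_zero] at hab
  exact (QuotientAddGroup.eq_zero_iff _).1 hab

end AcyclicPair

/-- If `G` is generated by two involutions whose product has infinite order, and `M` satisfies
`AcyclicPair`, then the homology of `G` with coefficients in `M` vanishes in positive degrees. -/
theorem AcyclicPair.vanishesInDegreeSucc.{u, v} {G : Type u} [Group G] {s t : G} (hs : s * s = 1) (ht : t * t = 1)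
    (hgen : Subgroup.closure {s, t} = ⊤) (hst : Function.Injective fun k : ℕ => (s * t) ^ k)
    (n : ℕ) {M : Type (max u v)} [AddCommGroup M] [DistribMulAction G M] (h : AcyclicPair M s t) :
    VanishesInDegreeSucc G M n := by
  induction n generalizing M with
  | zero => exact h.vanishesInDegreeSucc_zero hs ht hgen
  | succ n ih => exact DiagonalModule.vanishesInDegreeSucc_succ (ih (h.augmentationKernel hst))

end GroupHomologyVanishing

section DegreeZero

theorem GroupHomology.nonempty_zero_addEquiv {G M T : Type*} [Group G] [AddCommGroup M]
    [DistribMulAction G M] [AddCommGroup T] (Ψ : M →+ T) (hsurj : Function.Surjective Ψ)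
    (hinv : ∀ (g : G) m, Ψ (g • m) = Ψ m)
    (hker : Ψ.ker ≤ AddSubgroup.closure {x | ∃ (g : G) (m : M), x = g • m - m}) :
    Nonempty (GroupHomology G M 0 ≃+ T) := by
  set ev : ((Fin 0 → G) →₀ M) →+ M := Finsupp.applyAddHom default
  have hev : ∀ c : (Fin 0 → G) →₀ M, Finsupp.single default (ev c) = c := fun c =>
    (Finsupp.unique_single c).symm
  have hrange : ∀ c, Ψ (ev c) = 0 ↔ c ∈ (inhomogeneousChainsD G M 0).range := by
    intro c
    constructor
    · intro hc
      have h1 : AddSubgroup.closure {x | ∃ (g : G) (m : M), x = g • m - m} ≤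
          (inhomogeneousChainsD G M 0).range.comap (Finsupp.singleAddHom default) := by
        rw [AddSubgroup.closure_le]
        rintro _ ⟨g, m, rfl⟩
        exact ⟨Finsupp.single (fun _ => g⁻¹) m, by
          rw [inhomogeneousChainsD_zero_single, inv_inv]; rfl⟩
      have h2 : Finsupp.single default (ev c) ∈ (inhomogeneousChainsD G M 0).range :=
        h1 (hker hc)
      rwa [hev] at h2
    · rintro ⟨w, rfl⟩
      induction w using Finsupp.induction_linear with
      | zero => simp
      | add a b ha hb => rw [map_add, map_add, map_add, ha, hb, add_zero]
      | single g m =>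
        rw [inhomogeneousChainsD_zero_single]
        simp [ev, hinv]
  set Φ : homologyCycles G M 0 →+ T := (Ψ.comp ev).comp (AddSubgroup.subtype _)
  have hΦ : Function.Surjective Φ := fun y => by
    obtain ⟨m, rfl⟩ := hsurj y
    exact ⟨⟨Finsupp.single default m, AddSubgroup.mem_top _⟩, by simp [Φ, ev]⟩
  refine ⟨(QuotientAddGroup.quotientAddEquivOfEq ?_).trans
    (QuotientAddGroup.quotientKerEquivOfSurjective Φ hΦ)⟩
  ext c
  exact (hrange c.1).symm

theorem exists_addMonoidHom_zmod_two {A : Type*} [AddCommGroup A] (N : AddSubgroup A) (e : A)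
    (he : ∀ n ∈ N, ∀ y, e ≠ n + (y + y)) :
    ∃ L : A →+ ZMod 2, N ≤ L.ker ∧ L e = 1 := by
  set N' : AddSubgroup A := N ⊔ (nsmulAddMonoidHom 2 : A →+ A).range
  let : Module (ZMod 2) (A ⧸ N') := AddCommGroup.zmodModule fun x => by
    obtain ⟨y, rfl⟩ := QuotientAddGroup.mk_surjective x
    exact (QuotientAddGroup.eq_zero_iff _).2 (AddSubgroup.mem_sup_right ⟨y, rfl⟩)
  have hne : (QuotientAddGroup.mk' N' e) ≠ 0 := fun h => by
    obtain ⟨n, hn, _, ⟨y, rfl⟩, hy⟩ :=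
      AddSubgroup.mem_sup.1 ((QuotientAddGroup.eq_zero_iff _).1 h)
    refine he n hn y ?_
    rw [← hy, nsmulAddMonoidHom_apply, two_nsmul]
  obtain ⟨f, hf⟩ : ∃ f : Module.Dual (ZMod 2) (A ⧸ N'), f (QuotientAddGroup.mk' N' e) ≠ 0 := by
    by_contra! h
    exact hne ((Module.forall_dual_apply_eq_zero_iff (ZMod 2) _).1 h)
  refine ⟨f.toAddMonoidHom.comp (QuotientAddGroup.mk' N'), fun n hn => ?_, ?_⟩
  · have h0 : QuotientAddGroup.mk' N' n = 0 :=
      (QuotientAddGroup.eq_zero_iff _).2 (AddSubgroup.mem_sup_left hn)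
    rw [AddMonoidHom.mem_ker, AddMonoidHom.comp_apply, h0, map_zero]
  · have h2 : ∀ a : ZMod 2, a ≠ 0 → a = 1 := by decide
    exact h2 _ hf

end DegreeZero

section FreeInvolution

variable {X : Type*} [TopologicalSpace X] [CompactSpace X] [T2Space X]
  [TotallyDisconnectedSpace X]

theorem exists_isClopen_disjoint_preimage {τ : C(X, X)} {x : X} (hfree : τ x ≠ x) :
    ∃ U : Set X, IsClopen U ∧ x ∈ U ∧ ∀ y ∈ U, τ y ∉ U := by
  obtain ⟨V, hV, hxV, hτV⟩ := exists_isClopen_of_totally_separated hfree.symm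
  refine ⟨V ∩ τ ⁻¹' Vᶜ, hV.inter (hV.compl.preimage τ.continuous), ⟨hxV, hτV⟩, ?_⟩
  exact fun y hy hy' => hy.2 hy'.1

/-- A fixed point free involution of a compact totally disconnected Hausdorff space admits a
clopen fundamental domain. -/
theorem exists_isClopen_fundamentalDomain {τ : C(X, X)} (hτ : ∀ x, τ (τ x) = x)
    (hfree : ∀ x, τ x ≠ x) : ∃ D : Set X, IsClopen D ∧ ∀ x, τ x ∈ D ↔ x ∉ D := by
  choose U hU hxU hUτ using fun x => exists_isClopen_disjoint_preimage (hfree x)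
  obtain ⟨F, hF⟩ := isCompact_univ.elim_finite_subcover U (fun x => (hU x).isOpen)
    fun x _ => Set.mem_iUnion.2 ⟨x, hxU x⟩
  have key : ∀ F : Finset X, ∃ D : Set X, IsClopen D ∧ (∀ x ∈ D, τ x ∉ D) ∧
      ∀ z ∈ F, ∀ x ∈ U z, x ∈ D ∨ τ x ∈ D := fun F => by
    classical
    induction F using Finset.induction_on with
    | empty => exact ⟨∅, isClopen_empty, by simp, by simp⟩
    | insert a F _ ih =>
      obtain ⟨D, hD, hDτ, hDF⟩ := ih
      refine ⟨D ∪ (U a \ (D ∪ τ ⁻¹' D)),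
        hD.union ((hU a).diff (hD.union (hD.preimage τ.continuous))), ?_, ?_⟩
      · rintro x (hx | ⟨hx, hx'⟩) (h | ⟨h, h'⟩)
        · exact hDτ x hx h
        · exact h' (Or.inr (by rwa [Set.mem_preimage, hτ]))
        · exact hx' (Or.inr h)
        · exact hUτ a x hx h
      · intro z hz x hx
        rcases Finset.mem_insert.1 hz with rfl | hz
        · by_cases h : x ∈ D ∪ τ ⁻¹' D
          · exact h.imp Or.inl Or.inl
          · exact Or.inl (Or.inr ⟨hx, h⟩)
        · exact (hDF z hz x hx).imp Or.inl Or.inl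
  obtain ⟨D, hD, hDτ, hDF⟩ := key F
  refine ⟨D, hD, fun x => ⟨fun h hx => hDτ x hx h, fun h => ?_⟩⟩
  obtain ⟨z, hz, hxz⟩ : ∃ z ∈ F, x ∈ U z := by simpa using hF (Set.mem_univ x)
  exact (hDF z hz x hxz).resolve_left h

theorem exists_continuousMap_add_comp_eq_one {τ : C(X, X)} (hτ : ∀ x, τ (τ x) = x)
    (hfree : ∀ x, τ x ≠ x) : ∃ d : C(X, ℤ), ∀ x, d x + d (τ x) = 1 := by
  obtain ⟨D, hD, hDτ⟩ := exists_isClopen_fundamentalDomain hτ hfree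
  refine ⟨LocallyConstant.charFn ℤ hD, fun x => ?_⟩
  by_cases hx : x ∈ D
  · have : τ x ∉ D := fun h => (hDτ x).1 h hx
    simp [LocallyConstant.coe_charFn, hx, this]
  · have := (hDτ x).2 hx
    simp [LocallyConstant.coe_charFn, hx, this]

end FreeInvolution

section DihedralCoinvariants

variable {X : Type*} [TopologicalSpace X] {φ σ : X ≃ₜ X}

theorem eq_of_comp_eq_self {Y : Type*} [TopologicalSpace Y] [T2Space Y]
    (hφmin : ∀ x : X, Dense (Set.range fun n : ℤ => (φ.toEquiv ^ n) x)) {F : X → Y}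
    (hF : Continuous F) (hinv : ∀ x, F (φ x) = F x) (x y : X) : F x = F y := by
  have hpow : ∀ n : ℤ, ∀ z, F ((φ.toEquiv ^ n) z) = F z := fun n => by
    induction n with
    | zero => simp
    | succ n ih => intro z; rw [zpow_add_one, Equiv.Perm.mul_apply, ih]; exact hinv z
    | pred n ih =>
      intro z
      rw [zpow_sub_one, Equiv.Perm.mul_apply, ih]
      have := hinv (φ.symm z)
      rw [φ.apply_symm_apply] at this
      exact this.symm
  have := Continuous.ext_on (f := F) (g := fun _ => F x) (hφmin x) hF continuous_const (by
    rintro _ ⟨n, rfl⟩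
    exact hpow n x)
  exact (congrFun this y).symm

theorem mem_coboundariesSubgroup {ψ : C(X, X)} {f : C(X, ℤ)} :
    f ∈ coboundariesSubgroup ψ ↔ ∃ h : C(X, ℤ), ∀ x, f x = h x - h (ψ x) := by
  constructor
  · rintro ⟨h, rfl⟩
    exact ⟨h, fun x => rfl⟩
  · rintro ⟨h, hh⟩
    exact ⟨h, ContinuousMap.ext fun x => (hh x).symm⟩

/-- The coinvariants `C(X, ℤ) / {h - h ∘ φ}` have no `2`-torsion when `φ` is minimal. -/
theorem mem_coboundariesSubgroup_of_add_self
    (hφmin : ∀ x : X, Dense (Set.range fun n : ℤ => (φ.toEquiv ^ n) x)) [Nonempty X]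
    {f : C(X, ℤ)} (hf : f + f ∈ coboundariesSubgroup (φ : C(X, X))) :
    f ∈ coboundariesSubgroup (φ : C(X, X)) := by
  obtain ⟨h, hh⟩ := mem_coboundariesSubgroup.1 hf
  simp only [ContinuousMap.add_apply, ContinuousMap.coe_coe] at hh
  obtain ⟨x₀⟩ := ‹Nonempty X›
  have hmod : ∀ x, h x % 2 = h x₀ % 2 := fun x =>
    eq_of_comp_eq_self (F := fun x => h x % 2) hφmin
      ((continuous_of_discreteTopology (f := fun n : ℤ => n % 2)).comp h.continuous)
      (fun x => by have := hh x; omega) x x₀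
  refine mem_coboundariesSubgroup.2
    ⟨⟨fun x => (h x - h x₀) / 2, (continuous_of_discreteTopology
      (f := fun n : ℤ => (n - h x₀) / 2)).comp h.continuous⟩, fun x => ?_⟩
  have h1 := hh x
  have h2 := hmod x
  have h3 := hmod (φ x)
  simp only [ContinuousMap.coe_mk]
  omega

/-- The homomorphism `f ↦ [f + f ∘ σ]`. -/
def symmetrization (φ σ : X ≃ₜ X) : C(X, ℤ) →+ onePlusSigmaStar φ σ :=
  ((QuotientAddGroup.mk' (coboundariesSubgroup (φ : C(X, X)))).comp
    (AddMonoidHom.mk' (fun f : C(X, ℤ) => f + f.comp (σ : C(X, X)))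
      (fun f g => by ext x; simp; ring))).codRestrict _
    fun f => ⟨_, ⟨f, rfl⟩, rfl⟩

theorem symmetrization_surjective (φ σ : X ≃ₜ X) : Function.Surjective (symmetrization φ σ) := by
  rintro ⟨_, _, ⟨f, rfl⟩, rfl⟩
  exact ⟨f, rfl⟩

theorem symmetrization_eq_zero_iff {f : C(X, ℤ)} :
    symmetrization φ σ f = 0 ↔ ∃ h : C(X, ℤ), ∀ x, f x + f (σ x) = h x - h (φ x) := by
  rw [← ZeroMemClass.coe_eq_zero]
  exact (QuotientAddGroup.eq_zero_iff _).trans mem_coboundariesSubgroup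

theorem symmetrization_eq_zero_of_add_self
    (hφmin : ∀ x : X, Dense (Set.range fun n : ℤ => (φ.toEquiv ^ n) x)) [Nonempty X]
    {f : C(X, ℤ)} (hf : symmetrization φ σ (f + f) = 0) : symmetrization φ σ f = 0 := by
  have h1 : f + f + (f + f).comp (σ : C(X, X)) ∈ coboundariesSubgroup (φ : C(X, X)) :=
    (QuotientAddGroup.eq_zero_iff _).1 (ZeroMemClass.coe_eq_zero.2 hf)
  have h2 : f + f.comp (σ : C(X, X)) ∈ coboundariesSubgroup (φ : C(X, X)) := by
    apply mem_coboundariesSubgroup_of_add_self hφmin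
    convert h1 using 1
    ext x
    simp only [ContinuousMap.add_apply, ContinuousMap.comp_apply]
    ring
  exact ZeroMemClass.coe_eq_zero.1 ((QuotientAddGroup.eq_zero_iff _).2 h2)

/-- The subgroup of `C(X, ℤ)` whose quotient is the coinvariants of the dihedral action. -/
def dihedralCoboundaries (φ σ : X ≃ₜ X) : AddSubgroup C(X, ℤ) :=
  coboundariesSubgroup (σ : C(X, X)) ⊔ coboundariesSubgroup (φ : C(X, X))

theorem mem_dihedralCoboundaries {f : C(X, ℤ)} :
    f ∈ dihedralCoboundaries φ σ ↔
      ∃ a b : C(X, ℤ), ∀ x, f x = a x - a (σ x) + (b x - b (φ x)) := by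
  constructor
  · intro hf
    obtain ⟨_, ⟨a, rfl⟩, _, ⟨b, rfl⟩, rfl⟩ := AddSubgroup.mem_sup.1 hf
    exact ⟨a, b, fun x => rfl⟩
  · rintro ⟨a, b, hab⟩
    exact AddSubgroup.mem_sup.2 ⟨_, ⟨a, rfl⟩, _, ⟨b, rfl⟩, ContinuousMap.ext fun x => (hab x).symm⟩

theorem apply_involution_apply (hσ : ∀ x, σ (σ x) = x) (hrel : ∀ x, σ (φ (σ x)) = φ.symm x)
    (x : X) : φ (σ (φ x)) = σ x := by
  have := hrel (σ x)
  rw [hσ] at this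
  rw [this, φ.apply_symm_apply]

theorem symmetrization_of_mem_dihedralCoboundaries (hσ : ∀ x, σ (σ x) = x)
    (hrel : ∀ x, σ (φ (σ x)) = φ.symm x) {f : C(X, ℤ)} (hf : f ∈ dihedralCoboundaries φ σ) :
    ∃ u : C(X, ℤ), (∀ x, u x + u (φ (σ x)) = 0) ∧ ∀ x, f x + f (σ x) = u x - u (φ x) := by
  obtain ⟨a, b, hab⟩ := mem_dihedralCoboundaries.1 hf
  refine ⟨b - b.comp ((φ : C(X, X)).comp (σ : C(X, X))), fun x => ?_, fun x => ?_⟩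
  · simp [apply_involution_apply hσ hrel, hσ]
  · simp only [hab, hσ, ContinuousMap.sub_apply, ContinuousMap.comp_apply, ContinuousMap.coe_coe,
      apply_involution_apply hσ hrel]
    ring

theorem mem_dihedralCoboundaries_of_even {d e h f : C(X, ℤ)} (hσ : ∀ x, σ (σ x) = x)
    (hd : ∀ x, d x + d (σ x) = 1) (he : ∀ x, e x + e (φ (σ x)) = 1) (k : ℤ)
    (hh : ∀ x, h x + h (φ (σ x)) = k + k) (hf : ∀ x, f x + f (σ x) = h x - h (φ x)) :
    f ∈ dihedralCoboundaries φ σ := by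
  set g : C(X, ℤ) := e * (h - ContinuousMap.const X k) with hg
  set f' : C(X, ℤ) := f - (g - g.comp (φ : C(X, X))) with hf'
  have hg' : ∀ x, g x - g (φ (σ x)) = h x - k := fun x => by
    simp only [hg, ContinuousMap.mul_apply, ContinuousMap.sub_apply, ContinuousMap.const_apply]
    linear_combination (h x - k) * he x - e (φ (σ x)) * hh x
  have hf0 : ∀ x, f' x + f' (σ x) = 0 := fun x => by
    have h1 := hg' (σ x)
    rw [hσ] at h1
    have h2 := hh (σ x)
    rw [hσ] at h2
    simp only [hf', ContinuousMap.sub_apply, ContinuousMap.comp_apply, ContinuousMap.coe_coe]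
    linear_combination hf x - hg' x - h1 - h2
  refine mem_dihedralCoboundaries.2 ⟨d * f', g, fun x => ?_⟩
  have h3 : f x = f' x + (g x - g (φ x)) := by simp [hf']
  have h4 : ∀ y, (d * f') y = d y * f' y := fun _ => rfl
  rw [h3, h4, h4]
  linear_combination -f' x * hd x + d (σ x) * hf0 x

/-- With `d` and `e` indicator functions of fundamental domains of the involutions `σ` and
`φ ∘ σ`, the kernel of `symmetrization` on coinvariants is generated by the class of `e - d`. -/
theorem mem_or_sub_mem_dihedralCoboundaries [Nonempty X]
    (hφmin : ∀ x : X, Dense (Set.range fun n : ℤ => (φ.toEquiv ^ n) x))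
    (hσ : ∀ x, σ (σ x) = x) (hrel : ∀ x, σ (φ (σ x)) = φ.symm x) {d e f : C(X, ℤ)}
    (hd : ∀ x, d x + d (σ x) = 1) (he : ∀ x, e x + e (φ (σ x)) = 1)
    (hf : symmetrization φ σ f = 0) :
    f ∈ dihedralCoboundaries φ σ ∨ f - (e - d) ∈ dihedralCoboundaries φ σ := by
  obtain ⟨h, hh⟩ := symmetrization_eq_zero_iff.1 hf
  obtain ⟨x₀⟩ := ‹Nonempty X›
  have hconst : ∀ x, h x + h (φ (σ x)) = h x₀ + h (φ (σ x₀)) := fun x =>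
    eq_of_comp_eq_self (F := fun x => h x + h (φ (σ x))) hφmin (by fun_prop) (fun x => by
      have h1 := hh x
      have h2 := hh (σ x)
      rw [hσ] at h2
      rw [apply_involution_apply hσ hrel]
      linarith) x x₀
  obtain ⟨k, hk | hk⟩ := Int.even_or_odd' (h x₀ + h (φ (σ x₀)))
  · exact Or.inl (mem_dihedralCoboundaries_of_even hσ hd he k
      (fun x => by rw [hconst, hk]; ring) hh)
  · refine Or.inr (mem_dihedralCoboundaries_of_even (h := h - e) hσ hd he k (fun x => ?_)
      fun x => ?_)
    · simp only [ContinuousMap.sub_apply]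
      linear_combination hconst x + hk - he x
    · have h1 := he (σ x)
      rw [hσ] at h1
      simp only [ContinuousMap.sub_apply]
      linear_combination hh x + hd x - h1

theorem sub_notMem_dihedralCoboundaries [Nonempty X]
    (hφmin : ∀ x : X, Dense (Set.range fun n : ℤ => (φ.toEquiv ^ n) x))
    (hσ : ∀ x, σ (σ x) = x) (hrel : ∀ x, σ (φ (σ x)) = φ.symm x) {d e : C(X, ℤ)}
    (hd : ∀ x, d x + d (σ x) = 1) (he : ∀ x, e x + e (φ (σ x)) = 1) :
    e - d ∉ dihedralCoboundaries φ σ := by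
  intro hmem
  obtain ⟨u, hu, hed⟩ := symmetrization_of_mem_dihedralCoboundaries hσ hrel hmem
  obtain ⟨x⟩ := ‹Nonempty X›
  have hconst := eq_of_comp_eq_self (F := fun x => e x - u x) hφmin (by fun_prop) (fun x => by
    have h1 := hed x
    have h2 := hd x
    have h3 := he (σ x)
    rw [hσ] at h3
    simp only [ContinuousMap.sub_apply] at h1
    linarith) x (φ (σ x))
  have h1 := hu x
  have h2 := he x
  omega

theorem exists_surjective_ker_eq_dihedralCoboundaries [Nonempty X]
    (hφmin : ∀ x : X, Dense (Set.range fun n : ℤ => (φ.toEquiv ^ n) x))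
    (hσ : ∀ x, σ (σ x) = x) (hrel : ∀ x, σ (φ (σ x)) = φ.symm x) {d e : C(X, ℤ)}
    (hd : ∀ x, d x + d (σ x) = 1) (he : ∀ x, e x + e (φ (σ x)) = 1) :
    ∃ Ψ : C(X, ℤ) →+ ZMod 2 × onePlusSigmaStar φ σ,
      Function.Surjective Ψ ∧ Ψ.ker = dihedralCoboundaries φ σ := by
  have hN : ∀ f ∈ dihedralCoboundaries φ σ, symmetrization φ σ f = 0 := fun f hf => by
    obtain ⟨u, -, hu⟩ := symmetrization_of_mem_dihedralCoboundaries hσ hrel hf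
    exact symmetrization_eq_zero_iff.2 ⟨u, hu⟩
  have hed : ∀ x, (e - d) x + (e - d) (σ x) = e x - e (φ x) := fun x => by
    have h3 := he (σ x)
    rw [hσ] at h3
    simp only [ContinuousMap.sub_apply]
    linear_combination h3 - hd x
  have hS : symmetrization φ σ (e - d) = 0 := symmetrization_eq_zero_iff.2 ⟨e, hed⟩
  have hdouble : (e - d) + (e - d) ∈ dihedralCoboundaries φ σ :=
    mem_dihedralCoboundaries_of_even (h := e + e) hσ hd he 1
      (fun x => by simp only [ContinuousMap.add_apply]; linear_combination 2 * he x)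
      (fun x => by simp only [ContinuousMap.add_apply]; linear_combination 2 * hed x)
  have hnot := sub_notMem_dihedralCoboundaries hφmin hσ hrel hd he
  obtain ⟨L, hLN, hL⟩ := exists_addMonoidHom_zmod_two (dihedralCoboundaries φ σ) (e - d)
    fun n hn y hy => hnot <| by
      have hy0 : symmetrization φ σ y = 0 := by
        apply symmetrization_eq_zero_of_add_self hφmin
        have := congrArg (symmetrization φ σ) hy
        rwa [map_add, hS, hN n hn, zero_add, eq_comm] at this
      rw [hy]
      refine add_mem hn ?_
      rcases mem_or_sub_mem_dihedralCoboundaries hφmin hσ hrel hd he hy0 with h | h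
      · exact add_mem h h
      · have := add_mem (add_mem h h) hdouble
        convert this using 1
        abel
  refine ⟨L.prod (symmetrization φ σ), ?_, le_antisymm (fun f hf => ?_) fun f hf => ?_⟩
  · rintro ⟨a, b⟩
    obtain ⟨y, rfl⟩ := symmetrization_surjective φ σ b
    have h2 : ∀ a b : ZMod 2, b = a ∨ b + 1 = a := by decide
    rcases h2 a (L y) with h | h
    · exact ⟨y, Prod.ext h rfl⟩
    · refine ⟨y + (e - d), Prod.ext ?_ ?_⟩
      · simpa [hL] using h
      · exact (map_add (symmetrization φ σ) _ _).trans (by rw [hS, add_zero])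
  · have h1 : L f = 0 := congrArg Prod.fst hf
    have h2 : symmetrization φ σ f = 0 := congrArg Prod.snd hf
    refine (mem_or_sub_mem_dihedralCoboundaries hφmin hσ hrel hd he h2).resolve_right fun h => ?_
    have h3 : L (f - (e - d)) = 0 := hLN h
    rw [map_sub, h1, hL] at h3
    exact absurd h3 (by decide)
  · exact Prod.ext (hLN hf) (hN f hf)

end DihedralCoinvariants

theorem DihedralGroup.closure_sr_r_mul_sr :
    Subgroup.closure {(sr 0 : DihedralGroup 0), r 1 * sr 0} = ⊤ := by
  set H := Subgroup.closure {(sr 0 : DihedralGroup 0), r 1 * sr 0}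
  have hs : (sr 0 : DihedralGroup 0) ∈ H := Subgroup.subset_closure (by simp)
  have ht : (r 1 * sr 0 : DihedralGroup 0) ∈ H := Subgroup.subset_closure (by simp)
  have hr : (r 1 : DihedralGroup 0) ∈ H := by
    have := mul_mem ht hs
    rwa [mul_assoc, sr_mul_self, mul_one] at this
  have hri : ∀ i : ZMod 0, (r i : DihedralGroup 0) ∈ H := fun i => by
    have := zpow_mem hr (show ℤ from i)
    rw [r_one_zpow] at this
    exact this
  rw [eq_top_iff]
  rintro (i | i) -
  · exact hri i
  · have := mul_mem hs (hri i)
    rwa [sr_mul_r, zero_add] at this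

theorem DihedralGroup.injective_pow_sr_mul_r_mul_sr :
    Function.Injective fun k : ℕ => (sr 0 * (r 1 * sr 0) : DihedralGroup 0) ^ k := by
  intro a b hab
  simp only [r_mul_sr, sr_mul_sr, r_pow, r.injEq] at hab
  have h : (-1 : ℤ) * a = -1 * b := by simpa using hab
  omega

/-- Homology of a free Cantor minimal `ℤ ⋊ ℤ₂`-system `α = (φ, σ)` with `φ` minimal (the
infinite dihedral group being `DihedralGroup 0`, acting on the module `C(X, ℤ)` with
`r 1 • f = f ∘ φ⁻¹` and `sr 0 • f = f ∘ σ`):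
`H₀ ≅ ℤ/2 ⊕ (1 + σ_*) H₀(ℤ, C(X, ℤ))` and `Hₙ = 0` for every `n ≥ 1`. -/
theorem homology_of_free_dihedral_system {X : Type*} [TopologicalSpace X] [CompactSpace X]
    [TopologicalSpace.MetrizableSpace X] [TotallyDisconnectedSpace X] [PerfectSpace X]
    [Nonempty X] (φ σ : X ≃ₜ X)
    (hσ : ∀ x, σ (σ x) = x) (hrel : ∀ x, σ (φ (σ x)) = φ.symm x)
    (hmin : ∀ x : X,
      Dense {y : X | ∃ (n : ℤ) (i : Bool), y = (φ.toEquiv ^ n) (cond i (σ x) x)})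
    (hφmin : ∀ x : X, Dense (Set.range fun n : ℤ => (φ.toEquiv ^ n) x))
    (hfree : ∀ (n : ℤ) (i : Bool) (x : X),
      (φ.toEquiv ^ n) (cond i (σ x) x) = x → n = 0 ∧ i = false)
    [DistribMulAction (DihedralGroup 0) C(X, ℤ)]
    (hr : ∀ f : C(X, ℤ),
      (DihedralGroup.r 1 : DihedralGroup 0) • f = f.comp (φ.symm : C(X, X)))
    (hsr : ∀ f : C(X, ℤ),
      (DihedralGroup.sr 0 : DihedralGroup 0) • f = f.comp (σ : C(X, X))) :
    Nonempty (GroupHomology (DihedralGroup 0) C(X, ℤ) 0 ≃+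
      ZMod 2 × onePlusSigmaStar φ σ) ∧
    (∀ n : ℕ, 1 ≤ n → ∀ x : GroupHomology (DihedralGroup 0) C(X, ℤ) n, x = 0) := by
  have hτrel : ∀ x, φ (σ (φ (σ x))) = x := fun x => by
    rw [apply_involution_apply hσ hrel, hσ]
  have hsymm : ∀ x, σ (φ.symm x) = φ (σ x) := fun x => by rw [← hrel, hσ]
  set s : DihedralGroup 0 := DihedralGroup.sr 0 with hs
  set t : DihedralGroup 0 := DihedralGroup.r 1 * DihedralGroup.sr 0 with ht
  have hs2 : s * s = 1 := DihedralGroup.sr_mul_self 0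
  have ht2 : t * t = 1 := by rw [ht, DihedralGroup.r_mul_sr, DihedralGroup.sr_mul_self]
  have hts : ∀ f : C(X, ℤ), t • f = f.comp ((φ : C(X, X)).comp (σ : C(X, X))) := fun f => by
    rw [ht, mul_smul, hsr, hr]
    ext x
    exact congrArg f (hsymm x)
  obtain ⟨d, hd⟩ := exists_continuousMap_add_comp_eq_one (τ := (σ : C(X, X))) hσ fun x hx => by
    simpa using (hfree 0 true x hx).2
  obtain ⟨e, he⟩ := exists_continuousMap_add_comp_eq_one
    (τ := (φ : C(X, X)).comp (σ : C(X, X))) hτrel fun x hx => by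
      simpa using (hfree 1 true x hx).2
  refine ⟨?_, fun n hn => ?_⟩
  · obtain ⟨Ψ, hsurj, hker⟩ :=
      exists_surjective_ker_eq_dihedralCoboundaries hφmin hσ hrel hd he
    have hΨs : ∀ f, Ψ (s • f) = Ψ f := fun f => by
      rw [eq_comm, ← sub_eq_zero, ← map_sub, ← AddMonoidHom.mem_ker, hker, hsr]
      exact AddSubgroup.mem_sup_left ⟨f, rfl⟩
    have hΨr : ∀ f, Ψ ((DihedralGroup.r 1 : DihedralGroup 0) • f) = Ψ f := fun f => by
      rw [← sub_eq_zero, ← map_sub, ← AddMonoidHom.mem_ker, hker, hr]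
      refine AddSubgroup.mem_sup_right ⟨f.comp (φ.symm : C(X, X)), ?_⟩
      ext x
      simp
    refine GroupHomology.nonempty_zero_addEquiv Ψ hsurj (fun g => ?_) ?_
    · have hg : g ∈ Subgroup.closure {s, t} :=
        DihedralGroup.closure_sr_r_mul_sr ▸ Subgroup.mem_top g
      induction hg using Subgroup.closure_induction with
      | mem x hx =>
        rcases hx with rfl | rfl
        · exact hΨs
        · exact fun m => by rw [ht, mul_smul, hΨr, hΨs]
      | one => simp
      | mul x y _ _ hx hy => exact fun m => by rw [mul_smul, hx, hy]
      | inv x _ hx => exact fun m => by rw [← hx, smul_inv_smul]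
    · rw [hker]
      refine sup_le ?_ ?_
      · rintro _ ⟨a, rfl⟩
        rw [← neg_mem_iff]
        refine AddSubgroup.subset_closure ⟨s, a, ?_⟩
        rw [hsr]
        exact neg_sub _ _
      · rintro _ ⟨b, rfl⟩
        refine AddSubgroup.subset_closure ⟨DihedralGroup.r 1, b.comp (φ : C(X, X)), ?_⟩
        rw [hr]
        ext x
        simp
  · obtain ⟨n, rfl⟩ := Nat.exists_eq_add_of_le' hn
    refine GroupHomology.eq_zero_of_vanishesInDegreeSucc
      (AcyclicPair.vanishesInDegreeSucc hs2 ht2 DihedralGroup.closure_sr_r_mul_sr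
        DihedralGroup.injective_pow_sr_mul_r_mul_sr n ⟨⟨AddMonoidHom.mulLeft d, fun f => ?_⟩,
          ⟨AddMonoidHom.mulLeft e, fun f => ?_⟩, fun f hfs hft => ?_⟩)
    · rw [hsr, hsr]
      ext x
      have := hd x
      simp only [ContinuousMap.coe_coe] at this
      simp only [AddMonoidHom.coe_mulLeft, ContinuousMap.add_apply, ContinuousMap.comp_apply,
        ContinuousMap.mul_apply, ContinuousMap.coe_coe]
      linear_combination f (σ x) * this
    · rw [hts, hts]
      ext x
      have := he x
      simp only [ContinuousMap.comp_apply, ContinuousMap.coe_coe] at this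
      simp only [AddMonoidHom.coe_mulLeft, ContinuousMap.add_apply, ContinuousMap.comp_apply,
        ContinuousMap.mul_apply, ContinuousMap.coe_coe]
      linear_combination f (φ (σ x)) * this
    · rw [hsr] at hfs
      rw [hts] at hft
      have h1 : ∀ x, f (σ x) = -f x := fun x => DFunLike.congr_fun hfs x
      have h2 : ∀ x, f (φ (σ x)) = -f x := fun x => DFunLike.congr_fun hft x
      have h3 : ∀ x, f (φ x) = f x := fun x => by
        have := h2 (σ x)
        rwa [hσ, h1, neg_neg] at this
      ext x
      have h4 := eq_of_comp_eq_self hφmin f.continuous h3 (σ x) x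
      have h5 := h1 x
      rw [ContinuousMap.zero_apply]
      omega
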